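/- The intersection ⋂_{n≥1} I(B)ⁿ is exactly the two-sided ideal of B generated by the images of r₃ and r₄. Consequently, the quotient of B by ⋂_{n≥1} I(B)ⁿ is isomorphic, as an augmented k-algebra, to A = F/(r₁, r₂, r₃, r₄), the quotient of F by the two-sided ideal generated by all four relations. -/

import Mathlib

noncomputable section

/-- The augmentation ideal of an augmented `k`-algebra, as a `k`-submodule. -/
def augIdeal {k A : Type*} [CommRing k] [Ring A] [Algebra k A] (ε : A →ₐ[k] k) :
    Submodule k A :=
  LinearMap.ker ε.toLinearMap

variable (k : Type*) [CommRing k]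

/-- The generators `x₁, x₂, y₁, y₂` of the free algebra `F` on four generators:
`x₁ = Xg k 0`, `x₂ = Xg k 1`, `y₁ = Xg k 2`, `y₂ = Xg k 3`. -/
def Xg (i : Fin 4) : FreeAlgebra k (Fin 4) := FreeAlgebra.ι k i

/-- `r₁ = x₁x₂ + y₁² − y₁`. -/
def r1 : FreeAlgebra k (Fin 4) := Xg k 0 * Xg k 1 + Xg k 2 * Xg k 2 - Xg k 2
/-- `r₂ = x₂x₁ + y₂² − y₂`. -/
def r2 : FreeAlgebra k (Fin 4) := Xg k 1 * Xg k 0 + Xg k 3 * Xg k 3 - Xg k 3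
/-- `r₃ = x₁y₂ − y₁x₁`. -/
def r3 : FreeAlgebra k (Fin 4) := Xg k 0 * Xg k 3 - Xg k 2 * Xg k 0
/-- `r₄ = x₂y₁ − y₂x₂`. -/
def r4 : FreeAlgebra k (Fin 4) := Xg k 1 * Xg k 2 - Xg k 3 * Xg k 1

/-- The relations of `B = F/(r₁, r₂)`. -/
def relB : FreeAlgebra k (Fin 4) → FreeAlgebra k (Fin 4) → Prop := fun a b =>
  (a = r1 k ∨ a = r2 k) ∧ b = 0

/-- The relations of `A = F/(r₁, r₂, r₃, r₄)`. -/
def relA : FreeAlgebra k (Fin 4) → FreeAlgebra k (Fin 4) → Prop := fun a b =>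
  (a = r1 k ∨ a = r2 k ∨ a = r3 k ∨ a = r4 k) ∧ b = 0

/-- `B = F/(r₁, r₂)`. -/
def AlgB : Type _ := RingQuot (relB k)
/-- `A = F/(r₁, r₂, r₃, r₄)`. -/
def AlgA : Type _ := RingQuot (relA k)

instance : Ring (AlgB k) := by unfold AlgB; infer_instance
instance : Algebra k (AlgB k) := by unfold AlgB; infer_instance
instance : Ring (AlgA k) := by unfold AlgA; infer_instance
instance : Algebra k (AlgA k) := by unfold AlgA; infer_instance

/-- The projection `F → B`. -/
def mkB : FreeAlgebra k (Fin 4) →ₐ[k] AlgB k := RingQuot.mkAlgHom k (relB k)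
/-- The projection `F → A`. -/
def mkA : FreeAlgebra k (Fin 4) →ₐ[k] AlgA k := RingQuot.mkAlgHom k (relA k)

/-- The augmentation of `B`, sending every generator to `0`. -/
def εB : AlgB k →ₐ[k] k :=
  RingQuot.liftAlgHom k
    ⟨FreeAlgebra.lift k (fun _ => (0 : k)), by
      rintro a b ⟨h, rfl⟩
      rcases h with rfl | rfl <;> simp [r1, r2, Xg]⟩

/-- The augmentation of `A`, sending every generator to `0`. -/
def εA : AlgA k →ₐ[k] k :=
  RingQuot.liftAlgHom k
    ⟨FreeAlgebra.lift k (fun _ => (0 : k)), by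
      rintro a b ⟨h, rfl⟩
      rcases h with rfl | rfl | rfl | rfl <;> simp [r1, r2, r3, r4, Xg]⟩

/-- The natural projection `B = F/(r₁,r₂) → A = F/(r₁,r₂,r₃,r₄)`. -/
def πBA : AlgB k →ₐ[k] AlgA k :=
  RingQuot.liftAlgHom k
    ⟨mkA k, by
      rintro a b ⟨h, rfl⟩
      exact RingQuot.mkAlgHom_rel k (⟨by tauto, rfl⟩ : relA k a 0)⟩

section Augmentation

variable {k}
variable {R S : Type*} [Ring R] [Algebra k R] [Ring S] [Algebra k S]

theorem mem_augIdeal {ε : R →ₐ[k] k} {a : R} : a ∈ augIdeal ε ↔ ε a = 0 := Iff.rfl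

theorem mul_mem_augIdeal_pow_left (ε : R →ₐ[k] k) {n : ℕ} (hn : 1 ≤ n) (b : R) {a : R}
    (ha : a ∈ augIdeal ε ^ n) : b * a ∈ augIdeal ε ^ n := by
  obtain ⟨m, rfl⟩ := Nat.exists_eq_add_of_le' hn
  rw [pow_succ'] at ha ⊢
  induction ha using Submodule.mul_induction_on' with
  | mem_mul_mem i hi j hj =>
    rw [← mul_assoc]
    exact Submodule.mul_mem_mul (by simp_all [mem_augIdeal]) hj
  | add x _ y _ hx hy => rw [mul_add]; exact add_mem hx hy

theorem mul_mem_augIdeal_pow_right (ε : R →ₐ[k] k) {n : ℕ} (hn : 1 ≤ n) {a : R} (b : R)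
    (ha : a ∈ augIdeal ε ^ n) : a * b ∈ augIdeal ε ^ n := by
  obtain ⟨m, rfl⟩ := Nat.exists_eq_add_of_le' hn
  rw [pow_succ] at ha ⊢
  induction ha using Submodule.mul_induction_on' with
  | mem_mul_mem i hi j hj =>
    rw [mul_assoc]
    exact Submodule.mul_mem_mul hi (by simp_all [mem_augIdeal])
  | add x _ y _ hx hy => rw [add_mul]; exact add_mem hx hy

theorem augIdeal_pow_succ_le (ε : R →ₐ[k] k) {n : ℕ} (hn : 1 ≤ n) :
    augIdeal ε ^ (n + 1) ≤ augIdeal ε ^ n := by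
  rw [pow_succ, Submodule.mul_le]
  exact fun _ hi j _ => mul_mem_augIdeal_pow_right ε hn j hi

/-- A positive power of the augmentation ideal, as a two-sided ideal. -/
def augIdealPow (ε : R →ₐ[k] k) (n : ℕ) (hn : 1 ≤ n) : TwoSidedIdeal R :=
  .mk' (augIdeal ε ^ n : Submodule k R) (zero_mem _) add_mem neg_mem
    (mul_mem_augIdeal_pow_left ε hn _) (mul_mem_augIdeal_pow_right ε hn _)

theorem mem_augIdealPow {ε : R →ₐ[k] k} {n : ℕ} {hn : 1 ≤ n} {a : R} :
    a ∈ augIdealPow ε n hn ↔ a ∈ augIdeal ε ^ n :=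
  TwoSidedIdeal.mem_mk' ..

theorem augIdeal_map {φ : R →ₐ[k] S} {ε : R →ₐ[k] k} {ε' : S →ₐ[k] k} (h : ε'.comp φ = ε)
    (hφ : Function.Surjective φ) : (augIdeal ε).map φ.toLinearMap = augIdeal ε' := by
  subst h
  ext b
  obtain ⟨a, rfl⟩ := hφ b
  constructor
  · rintro ⟨c, hc, hca⟩
    rw [mem_augIdeal, ← hca]
    exact hc
  · exact fun ha => ⟨a, ha, rfl⟩

theorem augIdeal_pow_map {φ : R →ₐ[k] S} {ε : R →ₐ[k] k} {ε' : S →ₐ[k] k} (h : ε'.comp φ = ε)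
    {n : ℕ} {a : R} (ha : a ∈ augIdeal ε ^ n) : φ a ∈ augIdeal ε' ^ n := by
  have hle : (augIdeal ε).map φ.toLinearMap ≤ augIdeal ε' := by
    subst h
    rintro _ ⟨c, hc, rfl⟩
    exact hc
  have := Submodule.mem_map_of_mem (f := φ.toLinearMap) ha
  rw [Submodule.map_pow] at this
  exact pow_le_pow_left' hle n this

end Augmentation

section Quotients

variable {k}
variable {R : Type*} [Ring R] [Algebra k R]

theorem mem_of_mkA_eq_zero (L : TwoSidedIdeal R) (ψ : FreeAlgebra k (Fin 4) →ₐ[k] R)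
    (h1 : ψ (r1 k) ∈ L) (h2 : ψ (r2 k) ∈ L) (h3 : ψ (r3 k) ∈ L) (h4 : ψ (r4 k) ∈ L)
    {f : FreeAlgebra k (Fin 4)} (hf : mkA k f = 0) : ψ f ∈ L := by
  have key : ∀ a, (L.ringCon.mkₐ k) a = 0 ↔ a ∈ L := fun a => by
    rw [TwoSidedIdeal.mem_iff]
    exact RingCon.eq L.ringCon
  have w : ∀ ⦃a b⦄, relA k a b →
      ((L.ringCon.mkₐ k).comp ψ) a = ((L.ringCon.mkₐ k).comp ψ) b := by
    rintro a b ⟨h, rfl⟩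
    rw [map_zero, AlgHom.comp_apply, key]
    rcases h with rfl | rfl | rfl | rfl <;> assumption
  have := RingQuot.liftAlgHom_mkAlgHom_apply (S := k) _ w f
  rw [← key]
  change _ = (L.ringCon.mkₐ k) (ψ f) at this
  rw [← this]
  exact (congrArg _ hf).trans (map_zero _)

theorem mkB_surjective : Function.Surjective (mkB k) := RingQuot.mkAlgHom_surjective k _

theorem mkA_surjective : Function.Surjective (mkA k) := RingQuot.mkAlgHom_surjective k _

theorem πBA_mkB (f : FreeAlgebra k (Fin 4)) : πBA k (mkB k f) = mkA k f :=
  RingQuot.liftAlgHom_mkAlgHom_apply ..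

theorem εB_mkB (f : FreeAlgebra k (Fin 4)) :
    εB k (mkB k f) = FreeAlgebra.lift k (fun _ => (0 : k)) f :=
  RingQuot.liftAlgHom_mkAlgHom_apply ..

theorem εA_mkA (f : FreeAlgebra k (Fin 4)) :
    εA k (mkA k f) = FreeAlgebra.lift k (fun _ => (0 : k)) f :=
  RingQuot.liftAlgHom_mkAlgHom_apply ..

theorem mkB_r1 : mkB k (r1 k) = 0 :=
  (RingQuot.mkAlgHom_rel k (s := relB k) (y := 0) ⟨.inl rfl, rfl⟩).trans (map_zero _)

theorem mkB_r2 : mkB k (r2 k) = 0 :=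
  (RingQuot.mkAlgHom_rel k (s := relB k) (y := 0) ⟨.inr rfl, rfl⟩).trans (map_zero _)

theorem mkA_eq_zero {a : FreeAlgebra k (Fin 4)}
    (h : a = r1 k ∨ a = r2 k ∨ a = r3 k ∨ a = r4 k) : mkA k a = 0 :=
  (RingQuot.mkAlgHom_rel k (s := relA k) (y := 0) ⟨h, rfl⟩).trans (map_zero _)

end Quotients

section Subgroups

theorem addSubgroupClass_submodule (R : Type*) [Ring R] [Algebra k R] :
    AddSubgroupClass (Submodule k R) R := inferInstance

instance : AddSubgroupClass (Submodule k (AlgB k)) (AlgB k) := addSubgroupClass_submodule k _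

instance : AddSubgroupClass (Submodule k (AlgA k)) (AlgA k) := addSubgroupClass_submodule k _

end Subgroups

section RelationsInB

/-- The two-sided ideal of `B` generated by the images of `r₃` and `r₄`, as a `k`-submodule. -/
def idealR3R4 : Submodule k (AlgB k) :=
  Submodule.span k
    {z : AlgB k | ∃ b c : AlgB k, z = b * mkB k (r3 k) * c ∨ z = b * mkB k (r4 k) * c}

variable {k}

theorem mul_mem_idealR3R4_left (a : AlgB k) {z : AlgB k} (hz : z ∈ idealR3R4 k) :
    a * z ∈ idealR3R4 k := by
  induction hz using Submodule.span_induction with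
  | mem z hz =>
    obtain ⟨b, c, rfl | rfl⟩ := hz
    · exact Submodule.subset_span ⟨a * b, c, .inl (by simp only [mul_assoc])⟩
    · exact Submodule.subset_span ⟨a * b, c, .inr (by simp only [mul_assoc])⟩
  | zero => simp
  | add x y _ _ hx hy => rw [mul_add]; exact add_mem hx hy
  | smul t x _ hx => rw [mul_smul_comm]; exact Submodule.smul_mem _ t hx

theorem mul_mem_idealR3R4_right (a : AlgB k) {z : AlgB k} (hz : z ∈ idealR3R4 k) :
    z * a ∈ idealR3R4 k := by
  induction hz using Submodule.span_induction with
  | mem z hz =>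
    obtain ⟨b, c, rfl | rfl⟩ := hz
    · exact Submodule.subset_span ⟨b, c * a, .inl (by simp only [mul_assoc])⟩
    · exact Submodule.subset_span ⟨b, c * a, .inr (by simp only [mul_assoc])⟩
  | zero => simp
  | add x y _ _ hx hy => rw [add_mul]; exact add_mem hx hy
  | smul t x _ hx => rw [smul_mul_assoc]; exact Submodule.smul_mem _ t hx

theorem ker_πBA_le : LinearMap.ker (πBA k).toLinearMap ≤ idealR3R4 k := by
  intro b hb
  obtain ⟨f, rfl⟩ := mkB_surjective b
  have hf : mkA k f = 0 := by rw [← πBA_mkB]; exact hb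
  let L : TwoSidedIdeal (AlgB k) :=
    .mk' (idealR3R4 k : Set (AlgB k)) (zero_mem _) add_mem neg_mem
      (mul_mem_idealR3R4_left _) (mul_mem_idealR3R4_right _)
  have hL : ∀ z, z ∈ L ↔ z ∈ idealR3R4 k := TwoSidedIdeal.mem_mk' _ _ _ _ _ _
  rw [← hL]
  refine mem_of_mkA_eq_zero L (mkB k) ?_ ?_ ?_ ?_ hf
  · rw [mkB_r1]; exact zero_mem L
  · rw [mkB_r2]; exact zero_mem L
  · exact (hL _).2 (Submodule.subset_span ⟨1, 1, .inl (by simp)⟩)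
  · exact (hL _).2 (Submodule.subset_span ⟨1, 1, .inr (by simp)⟩)

theorem mkB_Xg_mem (i : Fin 4) : mkB k (Xg k i) ∈ augIdeal (εB k) := by
  rw [mem_augIdeal, εB_mkB, Xg, FreeAlgebra.lift_ι_apply]

theorem mkB_r3_eq :
    mkB k (r3 k) = mkB k (Xg k 2) * mkB k (r3 k) + mkB k (r3 k) * mkB k (Xg k 3) := by
  have h : r3 k = Xg k 2 * r3 k + r3 k * Xg k 3 + (r1 k * Xg k 0 - Xg k 0 * r2 k) := by
    simp only [r1, r2, r3]; noncomm_ring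
  have := congrArg (mkB k) h
  simpa [mkB_r1, mkB_r2] using this

theorem mkB_r4_eq :
    mkB k (r4 k) = mkB k (Xg k 3) * mkB k (r4 k) + mkB k (r4 k) * mkB k (Xg k 2) := by
  have h : r4 k = Xg k 3 * r4 k + r4 k * Xg k 2 + (r2 k * Xg k 1 - Xg k 1 * r1 k) := by
    simp only [r1, r2, r4]; noncomm_ring
  have := congrArg (mkB k) h
  simpa [mkB_r1, mkB_r2] using this

theorem mem_augIdeal_pow_of_eq {R : Type*} [Ring R] [Algebra k R] {ε : R →ₐ[k] k} {a y y' : R}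
    (hy : y ∈ augIdeal ε) (hy' : y' ∈ augIdeal ε) (ha : a = y * a + a * y') (n : ℕ) :
    a ∈ augIdeal ε ^ (n + 1) := by
  induction n with
  | zero =>
    rw [mem_augIdeal] at hy hy'
    rw [zero_add, pow_one, mem_augIdeal, ha]
    simp [hy, hy']
  | succ n ih =>
    rw [ha]
    refine add_mem ?_ ?_
    · rw [pow_succ']; exact Submodule.mul_mem_mul hy ih
    · rw [pow_succ]; exact Submodule.mul_mem_mul ih hy'

theorem idealR3R4_le (n : ℕ) (hn : 1 ≤ n) : idealR3R4 k ≤ augIdeal (εB k) ^ n := by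
  refine Submodule.span_le.2 ?_
  obtain ⟨m, rfl⟩ := Nat.exists_eq_add_of_le' hn
  rintro _ ⟨b, c, rfl | rfl⟩
  · exact mul_mem_augIdeal_pow_right _ hn _ (mul_mem_augIdeal_pow_left _ hn _
      (mem_augIdeal_pow_of_eq (mkB_Xg_mem 2) (mkB_Xg_mem 3) mkB_r3_eq m))
  · exact mul_mem_augIdeal_pow_right _ hn _ (mul_mem_augIdeal_pow_left _ hn _
      (mem_augIdeal_pow_of_eq (mkB_Xg_mem 3) (mkB_Xg_mem 2) mkB_r4_eq m))

end RelationsInB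

section NormalForms

/-- The generator `x₁` (for `false`) or `x₂` (for `true`). -/
def xg (b : Bool) : FreeAlgebra k (Fin 4) := Xg k (bif b then 1 else 0)

/-- The generator `y₁` (for `false`) or `y₂` (for `true`). -/
def yg (b : Bool) : FreeAlgebra k (Fin 4) := Xg k (bif b then 3 else 2)

/-- The normal form attached to a word in two letters: reading from the left, a letter `b`
followed by the other letter contributes `y_b` and consumes both, and any other letter `b`
contributes `x_b`. -/
def normalForm : List Bool → FreeAlgebra k (Fin 4)
  | [] => 1
  | [b] => xg k b
  | b :: c :: w => if b = c then xg k b * normalForm (c :: w) else yg k b * normalForm w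

/-- The span of the normal forms in `A`. -/
def normalSpan : Submodule k (AlgA k) :=
  Submodule.span k (Set.range fun w => mkA k (normalForm k w))

variable {k}

theorem mkA_normalForm_mem (w : List Bool) : mkA k (normalForm k w) ∈ normalSpan k :=
  Submodule.subset_span ⟨w, rfl⟩

theorem mkA_xg_mul_xg (b : Bool) :
    mkA k (xg k b) * mkA k (xg k !b) = mkA k (yg k b) - mkA k (yg k b) * mkA k (yg k b) := by
  rw [← sub_eq_zero, ← map_mul, ← map_mul, ← map_sub, ← map_sub]
  refine mkA_eq_zero ?_
  cases b
  · left; simp only [xg, yg, r1, Bool.not_false, cond_true, cond_false]; abel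
  · right; left; simp only [xg, yg, r2, Bool.not_true, cond_true, cond_false]; abel

theorem mkA_xg_mul_yg (b : Bool) :
    mkA k (xg k b) * mkA k (yg k !b) = mkA k (yg k b) * mkA k (xg k b) := by
  rw [← sub_eq_zero, ← map_mul, ← map_mul, ← map_sub]
  refine mkA_eq_zero ?_
  cases b
  · right; right; left; rfl
  · right; right; right; rfl

theorem mul_mem_normalSpan {a : AlgA k}
    (h : ∀ w, a * mkA k (normalForm k w) ∈ normalSpan k) {z : AlgA k} (hz : z ∈ normalSpan k) :
    a * z ∈ normalSpan k := by
  induction hz using Submodule.span_induction with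
  | mem z hz => obtain ⟨w, rfl⟩ := hz; exact h w
  | zero => simp
  | add x y _ _ hx hy => rw [mul_add]; exact add_mem hx hy
  | smul t x _ hx => rw [mul_smul_comm]; exact Submodule.smul_mem _ t hx

theorem yg_mul_mem_normalSpan (b : Bool) {z : AlgA k} (hz : z ∈ normalSpan k) :
    mkA k (yg k b) * z ∈ normalSpan k := by
  refine mul_mem_normalSpan (fun w => ?_) hz
  have : normalForm k (b :: (!b) :: w) = yg k b * normalForm k w := by
    simp [normalForm]
  rw [← map_mul, ← this]
  exact mkA_normalForm_mem _

theorem xg_mul_normalForm_mem (b : Bool) :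
    ∀ w : List Bool, mkA k (xg k b) * mkA k (normalForm k w) ∈ normalSpan k
  | [] => by
    rw [← map_mul, show xg k b * normalForm k [] = normalForm k [b] by simp [normalForm]]
    exact mkA_normalForm_mem _
  | c :: w => by
    have hxx : ∀ z ∈ normalSpan k, mkA k (xg k b) * (mkA k (xg k !b) * z) ∈ normalSpan k := by
      intro z hz
      rw [← mul_assoc, mkA_xg_mul_xg, sub_mul, mul_assoc]
      exact sub_mem (yg_mul_mem_normalSpan b hz)
        (yg_mul_mem_normalSpan b (yg_mul_mem_normalSpan b hz))
    by_cases hbc : b = c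
    · have : normalForm k (b :: c :: w) = xg k b * normalForm k (c :: w) := by
        simp [normalForm, hbc]
      rw [← map_mul, ← this]
      exact mkA_normalForm_mem _
    · obtain rfl : c = !b := by cases b <;> cases c <;> simp_all
      match w with
      | [] =>
        have := hxx 1 (by simpa [normalForm] using mkA_normalForm_mem (k := k) [])
        simpa [normalForm] using this
      | d :: w =>
        by_cases hcd : (!b) = d
        · rw [normalForm, if_pos hcd, map_mul]
          exact hxx _ (mkA_normalForm_mem _)
        · rw [normalForm, if_neg hcd, map_mul, ← mul_assoc, mkA_xg_mul_yg, mul_assoc]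
          exact yg_mul_mem_normalSpan b (xg_mul_normalForm_mem b w)

theorem mul_mem_normalSpan_of_free (f : FreeAlgebra k (Fin 4)) {z : AlgA k}
    (hz : z ∈ normalSpan k) : mkA k f * z ∈ normalSpan k := by
  induction f using FreeAlgebra.induction generalizing z with
  | grade0 r => rw [AlgHom.commutes, ← Algebra.smul_def]; exact Submodule.smul_mem _ r hz
  | grade1 i =>
    fin_cases i
    · exact mul_mem_normalSpan (xg_mul_normalForm_mem false) hz
    · exact mul_mem_normalSpan (xg_mul_normalForm_mem true) hz
    · exact yg_mul_mem_normalSpan false hz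
    · exact yg_mul_mem_normalSpan true hz
  | mul f g hf hg => rw [map_mul, mul_assoc]; exact hf (hg hz)
  | add f g hf hg => rw [map_add, add_mul]; exact add_mem (hf hz) (hg hz)

theorem exists_normalForm (a : AlgA k) :
    ∃ c : List Bool →₀ k, mkA k (Finsupp.linearCombination k (normalForm k) c) = a := by
  obtain ⟨f, rfl⟩ := mkA_surjective a
  have h1 : (1 : AlgA k) ∈ normalSpan k := by
    simpa [normalForm] using mkA_normalForm_mem (k := k) []
  have hf := mul_mem_normalSpan_of_free f h1
  rw [mul_one, normalSpan, Finsupp.mem_span_range_iff_exists_finsupp] at hf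
  obtain ⟨c, hc⟩ := hf
  refine ⟨c, ?_⟩
  rw [← hc, Finsupp.linearCombination_apply, map_finsuppSum]
  simp

end NormalForms

section FreeWords

open Polynomial

/-- The free algebra on two letters, with its basis of words. -/
abbrev WordAlg := MonoidAlgebra k (FreeMonoid Bool)

/-- The augmentation of the free algebra on two letters. -/
def wordAug : WordAlg k →ₐ[k] k :=
  MonoidAlgebra.lift k k (FreeMonoid Bool) (FreeMonoid.lift fun _ => 0)

/-- A word, as an element of the free algebra on two letters. -/
def word (w : List Bool) : WordAlg k := MonoidAlgebra.single (FreeMonoid.ofList w) 1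

variable {k}

theorem word_append (v w : List Bool) : word k (v ++ w) = word k v * word k w := by
  simp [word, MonoidAlgebra.single_mul_single]

theorem word_cons (b : Bool) (w : List Bool) : word k (b :: w) = word k [b] * word k w :=
  word_append [b] w

theorem letter_mem (b : Bool) : word k [b] ∈ augIdeal (wordAug k) := by
  rw [mem_augIdeal, wordAug, word, MonoidAlgebra.lift_single]
  simp

theorem word_mem (w : List Bool) : word k w ∈ augIdeal (wordAug k) ^ w.length := by
  induction w with
  | nil => rw [List.length_nil, pow_zero]; exact Submodule.one_le.1 le_rfl
  | cons b w ih =>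
    rw [word_cons, List.length_cons, pow_succ']
    exact Submodule.mul_mem_mul (letter_mem b) ih

theorem wordAug_apply (t : WordAlg k) : wordAug k t = t.coeff 1 := by
  induction t using MonoidAlgebra.induction_linear with
  | zero => simp
  | add f g hf hg => simp [hf, hg]
  | single w a =>
    rw [wordAug, MonoidAlgebra.lift_single]
    cases w using FreeMonoid.casesOn with
    | one => simp
    | of_mul b w =>
      have : FreeMonoid.of b * w ≠ 1 := fun h => by simpa using congrArg FreeMonoid.length h
      simp [this]

theorem coeff_eq_zero_of_mem {n : ℕ} {t : WordAlg k} (ht : t ∈ augIdeal (wordAug k) ^ n)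
    (w : FreeMonoid Bool) (hw : w.length < n) : t.coeff w = 0 := by
  have h1 : augIdeal (wordAug k) ≤
      Submodule.span k (word k '' {w : List Bool | 1 ≤ w.length}) := by
    intro t ht
    rw [mem_augIdeal, wordAug_apply] at ht
    rw [← MonoidAlgebra.sum_coeff_single t]
    refine Submodule.sum_mem _ fun w hw => ?_
    rw [← mul_one (t.coeff w), ← smul_eq_mul, ← MonoidAlgebra.smul_single]
    refine Submodule.smul_mem _ _ (Submodule.subset_span ⟨w.toList, ?_, rfl⟩)
    rw [Set.mem_ofPred_eq, Nat.one_le_iff_ne_zero]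
    intro h
    obtain rfl : w = 1 := FreeMonoid.length_eq_zero.1 h
    simp_all
  have hn : augIdeal (wordAug k) ^ n ≤
      Submodule.span k (word k '' {w : List Bool | n ≤ w.length}) := by
    clear ht hw
    induction n with
    | zero =>
      rw [pow_zero, Submodule.one_eq_span, Submodule.span_le, Set.singleton_subset_iff]
      exact Submodule.subset_span ⟨[], by simp, rfl⟩
    | succ n ih =>
      rw [pow_succ]
      refine (mul_le_mul' ih h1).trans ?_
      rw [Submodule.span_mul_span, Submodule.span_le]
      rintro _ ⟨_, ⟨v, hv, rfl⟩, _, ⟨w, hw, rfl⟩, rfl⟩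
      refine Submodule.subset_span ⟨v ++ w, ?_, word_append v w⟩
      simp only [Set.mem_ofPred_eq, List.length_append] at *
      omega
  replace ht := hn ht
  induction ht using Submodule.span_induction with
  | mem z hz =>
    obtain ⟨v, hv, rfl⟩ := hz
    rw [word, MonoidAlgebra.coeff_single, Finsupp.single_eq_of_ne]
    rintro rfl
    exact absurd hw (not_lt.2 hv)
  | zero => simp
  | add x y _ _ hx hy => simp [hx, hy]
  | smul r x _ hx => simp [hx]

/-- Polynomial approximations to the power series `c` with `c = X + c²` and `c(0) = 0`. -/
theorem exists_polynomial_approx (n : ℕ) :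
    ∃ p : k[X], X ^ 2 ∣ p - X ∧ X ^ n ∣ X + p ^ 2 - p := by
  induction n with
  | zero => exact ⟨X, by simp, by simp⟩
  | succ n ih =>
    obtain ⟨p, h2, hn⟩ := ih
    have hX : (X : k[X]) ∣ p := by
      have := (dvd_trans (dvd_pow_self X two_ne_zero) h2).add (dvd_refl X)
      rwa [sub_add_cancel] at this
    refine ⟨X + p ^ 2, ?_, ?_⟩
    · rw [add_sub_cancel_left]; exact pow_dvd_pow_of_dvd hX 2
    · have : X + (X + p ^ 2) ^ 2 - (X + p ^ 2) = (X + p ^ 2 - p) * (X + p ^ 2 + p) := by ring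
      rw [this, pow_succ]
      exact mul_dvd_mul hn (((dvd_refl X).add (dvd_pow hX two_ne_zero)).add hX)

/-- The map from the free algebra on `x₁, x₂, y₁, y₂` to the free algebra on two letters which
sends `x_b` to the letter `b` and `y_b` to `p(x_b x_c)`, where `c` is the letter other than `b`. -/
def evalWord (p : k[X]) : FreeAlgebra k (Fin 4) →ₐ[k] WordAlg k :=
  FreeAlgebra.lift k ![word k [false], word k [true],
    aeval (word k [false, true]) p, aeval (word k [true, false]) p]

theorem evalWord_xg (p : k[X]) (b : Bool) : evalWord p (xg k b) = word k [b] := by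
  cases b <;> simp [evalWord, xg, Xg]

theorem evalWord_yg (p : k[X]) (b : Bool) :
    evalWord p (yg k b) = aeval (word k [b, !b]) p := by
  cases b <;> simp [evalWord, yg, Xg]

theorem word_mul_aeval (p : k[X]) (b : Bool) :
    word k [b] * aeval (word k [!b, b]) p = aeval (word k [b, !b]) p * word k [b] := by
  induction p using Polynomial.induction_on' with
  | add p q hp hq => simp only [map_add, mul_add, add_mul, hp, hq]
  | monomial n a =>
    have h : SemiconjBy (word k [b]) (word k [!b, b]) (word k [b, !b]) := by
      simp only [SemiconjBy, ← word_append, List.cons_append, List.nil_append]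
    simp only [aeval_monomial]
    rw [← mul_assoc, ← Algebra.commutes, mul_assoc, (h.pow_right n).eq, mul_assoc]

theorem aeval_word_mem {n : ℕ} (hn : 1 ≤ n) {q : k[X]} (hq : X ^ n ∣ q) (b c : Bool) :
    aeval (word k [b, c]) q ∈ augIdeal (wordAug k) ^ n := by
  obtain ⟨s, rfl⟩ := hq
  rw [map_mul, map_pow, aeval_X]
  refine mul_mem_augIdeal_pow_right _ hn _ (Submodule.pow_mem_pow _ ?_ n)
  have := mul_mem_augIdeal_pow_right (wordAug k) le_rfl (word k [c])
    (by simpa using letter_mem (k := k) b)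
  rwa [pow_one, ← word_cons] at this

theorem evalWord_yg_sub_mem {p : k[X]} (hp : X ^ 2 ∣ p - X) (b : Bool) :
    evalWord p (yg k b) - word k [b, !b] ∈ augIdeal (wordAug k) ^ 3 := by
  have : evalWord p (yg k b) - word k [b, !b] = aeval (word k [b, !b]) (p - X) := by
    rw [evalWord_yg, map_sub, aeval_X]
  rw [this]
  obtain ⟨s, hs⟩ := hp
  have h4 : word k [b, !b] ^ 2 = word k [b, !b, b] * word k [!b] := by
    rw [pow_two, ← word_append, ← word_append]; rfl
  rw [hs, map_mul, map_pow, aeval_X, h4, mul_assoc]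
  exact mul_mem_augIdeal_pow_right _ (by norm_num) _ (word_mem [b, !b, b])

theorem wordAug_comp_evalWord {p : k[X]} (hp : X ^ 2 ∣ p - X) :
    (wordAug k).comp (evalWord p) = FreeAlgebra.lift k (fun _ => (0 : k)) := by
  have hX : (X : k[X]) ^ 1 ∣ p := by
    have := (dvd_trans (dvd_pow_self X two_ne_zero) hp).add (dvd_refl X)
    rwa [sub_add_cancel, ← pow_one X] at this
  have hy : ∀ b c, wordAug k (aeval (word k [b, c]) p) = 0 := fun b c => by
    have := aeval_word_mem le_rfl hX b c
    rwa [pow_one] at this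
  have hx : ∀ b, wordAug k (word k [b]) = 0 := letter_mem
  ext i
  fin_cases i <;> simp [evalWord, hx, hy]

theorem evalWord_normalForm {p : k[X]} (hp : X ^ 2 ∣ p - X) : ∀ w : List Bool,
    evalWord p (normalForm k w) ∈ augIdeal (wordAug k) ^ w.length ∧
      evalWord p (normalForm k w) - word k w ∈ augIdeal (wordAug k) ^ (w.length + 1)
  | [] => by
    have : word k [] = 1 := rfl
    simpa [normalForm, this, -Submodule.mem_one] using
      Submodule.one_le.1 (le_refl (1 : Submodule k (WordAlg k)))
  | [b] => by
    simpa [normalForm, evalWord_xg] using letter_mem b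
  | b :: c :: w => by
    by_cases hbc : b = c
    · obtain ⟨h1, h2⟩ := evalWord_normalForm hp (c :: w)
      rw [normalForm, if_pos hbc, map_mul, evalWord_xg, word_cons b (c :: w), ← mul_sub,
        List.length_cons (a := b), pow_succ' _ ((c :: w).length + 1),
        pow_succ' _ (c :: w).length]
      rw [pow_succ' _ (c :: w).length] at h2
      exact ⟨Submodule.mul_mem_mul (letter_mem b) h1, Submodule.mul_mem_mul (letter_mem b) h2⟩
    · obtain rfl : c = !b := by cases b <;> cases c <;> simp_all
      obtain ⟨h1, h2⟩ := evalWord_normalForm hp w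
      rw [normalForm, if_neg hbc, map_mul]
      set n := evalWord p (normalForm k w)
      set y := evalWord p (yg k b)
      have hy : y - word k [b, !b] ∈ augIdeal (wordAug k) ^ 3 := evalWord_yg_sub_mem hp b
      have hxx : word k [b, !b] ∈ augIdeal (wordAug k) ^ 2 := word_mem [b, !b]
      have hy2 : y ∈ augIdeal (wordAug k) ^ 2 := by
        rw [← sub_add_cancel y (word k [b, !b])]
        refine add_mem (augIdeal_pow_succ_le _ one_le_two hy) hxx
      have hw : word k (b :: (!b) :: w) = word k [b, !b] * word k w := word_append [b, !b] w
      have hl : (b :: (!b) :: w).length = 2 + w.length := by simp only [List.length_cons]; omega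
      rw [hl, hw, show y * n - word k [b, !b] * word k w =
        (y - word k [b, !b]) * n + word k [b, !b] * (n - word k w) by noncomm_ring]
      refine ⟨?_, add_mem ?_ ?_⟩
      · rw [pow_add]; exact Submodule.mul_mem_mul hy2 h1
      · rw [show 2 + w.length + 1 = 3 + w.length by omega, pow_add]
        exact Submodule.mul_mem_mul hy h1
      · rw [add_assoc, pow_add]; exact Submodule.mul_mem_mul hxx h2

theorem coeff_evalWord_normalForm {p : k[X]} (hp : X ^ 2 ∣ p - X) {v w : List Bool}
    (h : v.length ≤ w.length) :
    (evalWord p (normalForm k w)).coeff (FreeMonoid.ofList v) = if v = w then 1 else 0 := by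
  have h1 := coeff_eq_zero_of_mem (evalWord_normalForm hp w).2 (FreeMonoid.ofList v)
    (Nat.lt_succ_of_le h)
  rw [MonoidAlgebra.coeff_sub, Finsupp.sub_apply, sub_eq_zero] at h1
  rw [h1, word, MonoidAlgebra.coeff_single]
  split_ifs with hvw
  · rw [hvw, Finsupp.single_eq_same]
  · exact Finsupp.single_eq_of_ne fun h => hvw (FreeMonoid.ofList.injective h)

theorem evalWord_mem_of_mkA_eq_zero {n : ℕ} (hn : 1 ≤ n) {p : k[X]}
    (hpn : X ^ n ∣ X + p ^ 2 - p) {f : FreeAlgebra k (Fin 4)} (hf : mkA k f = 0) :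
    evalWord p f ∈ augIdeal (wordAug k) ^ n := by
  have hr : ∀ b, evalWord p (xg k b * xg k (!b) + yg k b * yg k b - yg k b) ∈
      augIdeal (wordAug k) ^ n := fun b => by
    have := aeval_word_mem hn hpn b (!b)
    rwa [map_sub, map_add, map_pow, aeval_X, pow_two, ← evalWord_yg, word_cons,
      ← evalWord_xg p, ← evalWord_xg p, ← map_mul, ← map_mul, ← map_add, ← map_sub] at this
  have hs : ∀ b, evalWord p (xg k b * yg k (!b) - yg k b * xg k b) = 0 := fun b => by
    have := word_mul_aeval p b
    rw [map_sub, map_mul, map_mul, evalWord_xg, evalWord_yg, evalWord_yg, Bool.not_not, this,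
      sub_self]
  rw [← mem_augIdealPow (hn := hn)]
  refine mem_of_mkA_eq_zero _ _ ?_ ?_ ?_ ?_ hf
  · exact mem_augIdealPow.2 (hr false)
  · exact mem_augIdealPow.2 (hr true)
  · exact mem_augIdealPow.2 (by rw [show evalWord p (r3 k) = 0 from hs false]; exact zero_mem _)
  · exact mem_augIdealPow.2 (by rw [show evalWord p (r4 k) = 0 from hs true]; exact zero_mem _)

theorem eq_zero_of_forall_mem_augIdeal_pow {a : AlgA k}
    (ha : ∀ n, 1 ≤ n → a ∈ augIdeal (εA k) ^ n) : a = 0 := by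
  obtain ⟨c, rfl⟩ := exists_normalForm a
  suffices c = 0 by simp [this]
  have key : ∀ m (v : List Bool), v.length = m → c v = 0 := by
    intro m
    induction m using Nat.strong_induction_on with
    | _ m ih =>
    rintro v rfl
    obtain ⟨p, hp, hpn⟩ := exists_polynomial_approx (k := k) (v.length + 1)
    have hm := ha (v.length + 1) (by omega)
    have hε : (εA k).comp (mkA k) = FreeAlgebra.lift k (fun _ => (0 : k)) :=
      AlgHom.ext εA_mkA
    rw [← augIdeal_map hε mkA_surjective, ← Submodule.map_pow] at hm
    obtain ⟨f, hf, hfc⟩ := hm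
    set g := Finsupp.linearCombination k (normalForm k) c with hg
    have hfg : mkA k (f - g) = 0 := by rw [map_sub, sub_eq_zero]; exact hfc
    have h1 := evalWord_mem_of_mkA_eq_zero (by omega) hpn hfg
    have h2 := augIdeal_pow_map (wordAug_comp_evalWord hp) hf
    have h3 : evalWord p g ∈ augIdeal (wordAug k) ^ (v.length + 1) := by
      have := sub_mem h2 h1
      rwa [map_sub, sub_sub_cancel] at this
    have h4 := coeff_eq_zero_of_mem h3 (FreeMonoid.ofList v) (Nat.lt_succ_self _)
    rw [hg, Finsupp.linearCombination_apply, map_finsuppSum, Finsupp.sum,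
      MonoidAlgebra.coeff_sum, Finsupp.finsetSum_apply] at h4
    have h5 : ∀ w ∈ c.support, (evalWord p (c w • normalForm k w)).coeff (FreeMonoid.ofList v) =
        if v = w then c w else 0 := fun w hw => by
      have hvw : v.length ≤ w.length := by
        by_contra! hlt
        exact (Finsupp.mem_support_iff.1 hw) (ih _ hlt w rfl)
      rw [map_smul, MonoidAlgebra.coeff_smul, Finsupp.smul_apply,
        coeff_evalWord_normalForm hp hvw, smul_eq_mul, mul_ite, mul_one, mul_zero]
    rw [Finset.sum_congr rfl h5, Finset.sum_ite_eq] at h4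
    simpa using h4
  exact Finsupp.ext fun v => key _ v rfl

end FreeWords

theorem εA_comp_πBA : (εA k).comp (πBA k) = εB k := by
  ext b
  obtain ⟨f, rfl⟩ := mkB_surjective b
  rw [AlgHom.comp_apply, πBA_mkB, εA_mkA, εB_mkB]

theorem iInf_augIdeal_pow_le_ker :
    (⨅ n ∈ {n : ℕ | 1 ≤ n}, augIdeal (εB k) ^ n) ≤ LinearMap.ker (πBA k).toLinearMap := by
  intro b hb
  simp only [Set.mem_ofPred_eq, Submodule.mem_iInf] at hb
  exact eq_zero_of_forall_mem_augIdeal_pow fun n hn =>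
    augIdeal_pow_map (εA_comp_πBA k) (hb n hn)

/-- `⋂_{n≥1} I(B)ⁿ` is exactly the two-sided ideal of `B` generated by the images of `r₃`
and `r₄`; consequently the quotient of `B` by `⋂_{n≥1} I(B)ⁿ` is isomorphic as an augmented
algebra to `A = F/(r₁,r₂,r₃,r₄)`: the natural projection `π : B → A` is surjective, has
kernel `⋂_{n≥1} I(B)ⁿ`, and commutes with the augmentations. -/
theorem inf_powers_eq_ideal_r3_r4 :
    (⨅ n ∈ {n : ℕ | 1 ≤ n}, augIdeal (εB k) ^ n) =
      Submodule.span k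
        {z : AlgB k | ∃ b c : AlgB k,
          z = b * mkB k (r3 k) * c ∨ z = b * mkB k (r4 k) * c}
    ∧ Function.Surjective (πBA k)
    ∧ LinearMap.ker (πBA k).toLinearMap = (⨅ n ∈ {n : ℕ | 1 ≤ n}, augIdeal (εB k) ^ n)
    ∧ (εA k).comp (πBA k) = εB k := by
  have hK : (⨅ n ∈ {n : ℕ | 1 ≤ n}, augIdeal (εB k) ^ n) = idealR3R4 k :=
    le_antisymm ((iInf_augIdeal_pow_le_ker k).trans ker_πBA_le) (le_iInf₂ idealR3R4_le)
  refine ⟨hK, fun a => ?_, ?_, εA_comp_πBA k⟩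
  · obtain ⟨f, rfl⟩ := mkA_surjective a
    exact ⟨mkB k f, πBA_mkB f⟩
  · exact le_antisymm (ker_πBA_le.trans hK.ge) (iInf_augIdeal_pow_le_ker k)
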